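/- Let a > 0 and fix t ∈ ℝ. Define on [0,∞) the functions ρ(t,x) = 15 a² cosh(a t)⁻⁴ cosh(3 a x)⁻⁴ and h(x) = cosh(3 a x)^{1/3} sinh(3 a x). Then the spatial average of the energy density on the t = const slice vanishes: (∫₀^R ρ(t,x) h(x) dx) / (∫₀^R h(x) dx) → 0 as R → ∞. Consequently the spatial averages of the energy density and of the pressure p = ρ/3 on every Cauchy slice of the singularity-free solution vanish, as required by the singularity theorem for any past geodesically complete model. -/

import Mathlib

open MeasureTheory Filter intervalIntegral Real

/-- The primitive of `cosh (b x) ^ r * sinh (b x)` for `r ≠ -1`. -/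
theorem integral_cosh_rpow_mul_sinh {b r : ℝ} (hb : b ≠ 0) (hr : r + 1 ≠ 0) (R : ℝ) :
    ∫ x in (0:ℝ)..R, Real.cosh (b * x) ^ r * Real.sinh (b * x) =
      (b * (r + 1))⁻¹ * (Real.cosh (b * R) ^ (r + 1) - 1) := by
  have hderiv (x : ℝ) : HasDerivAt (fun y => (b * (r + 1))⁻¹ * Real.cosh (b * y) ^ (r + 1))
      (Real.cosh (b * x) ^ r * Real.sinh (b * x)) x := by
    have hcosh := ((hasDerivAt_id x).const_mul b).cosh
    refine ((hcosh.rpow_const (p := r + 1) (Or.inl (Real.cosh_pos _).ne')).const_mul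
      (b * (r + 1))⁻¹).congr_deriv ?_
    simp only [id, add_sub_cancel_right]
    field_simp
  have hcont : Continuous fun x => Real.cosh (b * x) ^ r * Real.sinh (b * x) :=
    ((Real.continuous_cosh.comp (continuous_const_mul b)).rpow_const
      fun x => Or.inl (Real.cosh_pos _).ne').mul
      (Real.continuous_sinh.comp (continuous_const_mul b))
  rw [integral_eq_sub_of_hasDerivAt (fun x _ => hderiv x) (hcont.intervalIntegrable 0 R)]
  simp [mul_sub]

theorem tendsto_cosh_atTop : Tendsto Real.cosh atTop atTop := by
  refine tendsto_atTop_mono (fun x => ?_) (Real.tendsto_exp_atTop.atTop_div_const two_pos)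
  rw [Real.cosh_eq]
  gcongr
  exact le_add_of_nonneg_right (Real.exp_pos _).le

/-- The spatial average of the energy density
`ρ(t,x) = 15 a² cosh(at)⁻⁴ cosh(3ax)⁻⁴` of the singularity-free solution on any
`t = const` slice, taken with the spatial volume density
`h(x) = cosh(3ax)^{1/3} sinh(3ax)`, vanishes (hence so does that of `p = ρ/3`). -/
theorem spatial_average_energy_density_vanishes
    (a : ℝ) (ha : 0 < a) (t : ℝ)
    (ρ : ℝ → ℝ → ℝ) (h : ℝ → ℝ)
    (hρ : ∀ s x, ρ s x = 15 * a ^ 2 * (Real.cosh (a * s)) ^ (-4 : ℝ) *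
      (Real.cosh (3 * a * x)) ^ (-4 : ℝ))
    (hh : ∀ x, h x = (Real.cosh (3 * a * x)) ^ ((1 : ℝ) / 3) * Real.sinh (3 * a * x)) :
    Tendsto
      (fun R : ℝ => (∫ x in (0:ℝ)..R, ρ t x * h x) / ∫ x in (0:ℝ)..R, h x)
      atTop (nhds 0) := by
  have hb : 0 < 3 * a := by positivity
  have hcosh : Tendsto (fun R : ℝ => Real.cosh (3 * a * R)) atTop atTop :=
    tendsto_cosh_atTop.comp (tendsto_id.const_mul_atTop hb)
  have hnum (x : ℝ) : ρ t x * h x = 15 * a ^ 2 * Real.cosh (a * t) ^ (-4 : ℝ) *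
      (Real.cosh (3 * a * x) ^ (-(11 / 3) : ℝ) * Real.sinh (3 * a * x)) := by
    have hexp : (-(11 / 3) : ℝ) = -4 + 1 / 3 := by norm_num
    rw [hρ, hh, hexp, Real.rpow_add (Real.cosh_pos _)]
    ring
  simp_rw [hnum, hh, intervalIntegral.integral_const_mul]
  simp_rw [integral_cosh_rpow_mul_sinh hb.ne' (show (-(11 / 3) : ℝ) + 1 ≠ 0 by norm_num),
    integral_cosh_rpow_mul_sinh hb.ne' (show (1 / 3 : ℝ) + 1 ≠ 0 by norm_num)]
  have hdecay : Tendsto (fun R : ℝ => Real.cosh (3 * a * R) ^ (-(11 / 3) + 1 : ℝ))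
      atTop (nhds 0) := by
    rw [show (-(11 / 3) : ℝ) + 1 = -(8 / 3) by norm_num]
    exact (tendsto_rpow_neg_atTop (by norm_num)).comp hcosh
  have hgrow : Tendsto (fun R : ℝ => Real.cosh (3 * a * R) ^ (1 / 3 + 1 : ℝ)) atTop atTop :=
    (tendsto_rpow_atTop (by norm_num)).comp hcosh
  exact (((hdecay.sub_const 1).const_mul _).const_mul _).div_atTop
    ((tendsto_atTop_add_const_right _ (-1) hgrow).const_mul_atTop (by positivity))
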